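/- Let p be an odd prime and α, z ∈ ℤ_p. Then (∑_{k=0}^{p−1} (α)_k(1−α)_k/(k!)² · z^k)² ≡ ∑_{k=0}^{p−1} (α)_k(1−α)_k(1/2)_k/(k!)³ · (4z(1−z))^k (mod p²). (This is the p-adic analogue of Clausen's identity for the truncated hypergeometric series.) -/

import Mathlib

open scoped BigOperators

/-- The Pochhammer symbol `(x)_k = x(x+1)⋯(x+k-1)` in `ℚ_[p]`. -/
noncomputable def poch (p : ℕ) [Fact p.Prime] (x : ℚ_[p]) (k : ℕ) : ℚ_[p] :=
  (ascPochhammer ℚ_[p] k).eval x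

/-- The least non-negative residue `⟨α⟩_p ∈ {0,…,p-1}` of `α ∈ ℤ_[p]` modulo `p`. -/
noncomputable def res (p : ℕ) [Fact p.Prime] (α : ℤ_[p]) : ℕ :=
  (PadicInt.toZMod α).val

section Clausen

open Polynomial

theorem coeff_X_mul_derivative {R : Type*} [CommSemiring R] (f : R[X]) (m : ℕ) :
    (X * derivative f).coeff m = m * f.coeff m := by
  cases m with
  | zero => simp
  | succ k => rw [coeff_X_mul, coeff_derivative]; push_cast; ring

/-- The Legendre equation, from the recurrence satisfied by the coefficients. -/
theorem legendre_equation_of_coeff {K : Type*} [Field K] (N : K) (f : K[X])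
    (hf : ∀ k : ℕ, ((k : K) + 1) ^ 2 * f.coeff (k + 1) = ((k : K) ^ 2 + k - N) * f.coeff k) :
    (X - X ^ 2) * derivative (derivative f) + (1 - 2 * X) * derivative f + C N * f = 0 := by
  have key : X * derivative (X * derivative f)
      - X * (X * derivative (X * derivative f) + X * derivative f - C N * f) = 0 := by
    ext m
    cases m with
    | zero => simp
    | succ k =>
      rw [coeff_sub, coeff_X_mul_derivative, coeff_X_mul_derivative, coeff_X_mul]
      simp only [coeff_sub, coeff_add, coeff_X_mul_derivative, coeff_C_mul, coeff_zero]
      push_cast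
      linear_combination hf k
  refine mul_left_cancel₀ (X_ne_zero (R := K)) ?_
  rw [mul_zero, ← key]
  simp only [derivative_mul, derivative_X]
  ring

/-- The differential equation in `u = z(1-z)` satisfied by the right-hand side of Clausen's
identity, from the recurrence satisfied by the coefficients. -/
theorem clausen_equation_of_coeff {K : Type*} [Field K] (N : K) (g : K[X])
    (hg : ∀ k : ℕ, ((k : K) + 1) ^ 3 * g.coeff (k + 1)
      = 2 * (2 * k + 1) * ((k : K) ^ 2 + k - N) * g.coeff k) :
    X ^ 2 * (1 - 4 * X) * derivative (derivative (derivative g))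
      + (3 * X - 18 * X ^ 2) * derivative (derivative g)
      + (1 - 12 * X + 4 * C N * X) * derivative g + 2 * C N * g = 0 := by
  have key : X * derivative (X * derivative (X * derivative g))
      - X * (C 4 * (X * derivative (X * derivative (X * derivative g)))
        + C 6 * (X * derivative (X * derivative g))
        + C (2 - 4 * N) * (X * derivative g) - C (2 * N) * g) = 0 := by
    ext m
    cases m with
    | zero => simp
    | succ k =>
      rw [coeff_sub, coeff_X_mul_derivative, coeff_X_mul_derivative, coeff_X_mul_derivative,
        coeff_X_mul]
      simp only [coeff_sub, coeff_add, coeff_X_mul_derivative, coeff_C_mul, coeff_zero]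
      push_cast
      linear_combination hg k
  refine mul_left_cancel₀ (X_ne_zero (R := K)) ?_
  rw [mul_zero, ← key]
  simp only [derivative_mul, derivative_X, derivative_add, map_sub, map_mul, map_ofNat,
    derivative_one]
  ring

/-- The symmetric square of the Legendre equation has at most one polynomial solution with
given constant term. -/
theorem eq_zero_of_symmetric_square_legendre {K : Type*} [Field K] [CharZero K] (N : K)
    (h : K[X]) (h0 : h.coeff 0 = 0)
    (hL : (X - X ^ 2) ^ 2 * derivative (derivative (derivative h))
      + 3 * (X - X ^ 2) * (1 - 2 * X) * derivative (derivative h)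
      + ((1 - 2 * X) ^ 2 - 2 * (X - X ^ 2) + 4 * C N * (X - X ^ 2)) * derivative h
      + 2 * C N * (1 - 2 * X) * h = 0) : h = 0 := by
  have key : X * derivative (X * derivative (X * derivative h))
      - X * (C 2 * (X * derivative (X * derivative (X * derivative h)))
        + C 3 * (X * derivative (X * derivative h))
        + C (1 - 4 * N) * (X * derivative h) - C (2 * N) * h)
      + X * (X * (X * derivative (X * derivative (X * derivative h))
        + C 3 * (X * derivative (X * derivative h))
        + C (2 - 4 * N) * (X * derivative h) - C (4 * N) * h)) = 0 := by
    rw [← mul_zero X, ← hL]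
    simp only [derivative_mul, derivative_X, derivative_add, map_sub, map_mul, map_ofNat,
      derivative_one, map_one]
    ring
  have step : ∀ m, h.coeff m = 0 ∧ h.coeff (m + 1) = 0 := by
    intro m
    induction m with
    | zero =>
      refine ⟨h0, ?_⟩
      have := congrArg (fun q => q.coeff 1) key
      simp only [coeff_sub, coeff_add] at this
      rw [coeff_X_mul_derivative, coeff_X_mul_derivative, coeff_X_mul_derivative,
        coeff_X_mul, coeff_X_mul, coeff_X_mul_zero] at this
      simpa [coeff_X_mul_derivative, h0] using this
    | succ k ih =>
      refine ⟨ih.2, ?_⟩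
      have := congrArg (fun q => q.coeff (k + 2)) key
      simp only [coeff_sub, coeff_add] at this
      rw [coeff_X_mul_derivative, coeff_X_mul_derivative, coeff_X_mul_derivative,
        coeff_X_mul, coeff_X_mul, coeff_X_mul] at this
      simp only [coeff_sub, coeff_add, coeff_X_mul_derivative, coeff_C_mul, coeff_zero,
        ih.1, ih.2, mul_zero, add_zero, sub_zero] at this
      have hk : ((k + 2 : ℕ) : K) ≠ 0 := by exact_mod_cast (by omega : k + 2 ≠ 0)
      simpa only [pow_eq_zero_iff, mul_eq_zero, hk, false_or] using this
  ext m
  simpa using (step m).1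

/-- Clausen's identity for polynomial solutions. -/
theorem sq_eq_comp_of_coeff {K : Type*} [Field K] [CharZero K] (N : K) (f g : K[X])
    (hf : ∀ k : ℕ, ((k : K) + 1) ^ 2 * f.coeff (k + 1) = ((k : K) ^ 2 + k - N) * f.coeff k)
    (hg : ∀ k : ℕ, ((k : K) + 1) ^ 3 * g.coeff (k + 1)
      = 2 * (2 * k + 1) * ((k : K) ^ 2 + k - N) * g.coeff k)
    (hf0 : f.coeff 0 = 1) (hg0 : g.coeff 0 = 1) : f ^ 2 = g.comp (X - X ^ 2) := by
  have ef := legendre_equation_of_coeff N f hf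
  have ef' := congrArg derivative ef
  have eg := congrArg (fun q => q.comp (X - X ^ 2)) (clausen_equation_of_coeff N g hg)
  simp only [add_comp, mul_comp, sub_comp, pow_comp, X_comp, C_comp, ofNat_comp, one_comp,
    zero_comp] at eg
  simp only [derivative_mul, derivative_X, derivative_add, derivative_sub, derivative_pow,
    derivative_one, derivative_C, derivative_ofNat, derivative_zero] at ef'
  refine sub_eq_zero.mp (eq_zero_of_symmetric_square_legendre N _ ?_ ?_)
  · rw [coeff_zero_eq_eval_zero] at hf0 hg0 ⊢
    simp [eval_comp, hf0, hg0]
  · simp only [derivative_mul, derivative_X, derivative_add, derivative_sub, derivative_pow,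
      derivative_one, derivative_comp, derivative_C, derivative_zero]
    norm_num [show (C 2 : K[X]) = 2 from rfl] at ef' eg ⊢
    linear_combination 2 * (X - X ^ 2) * f * ef'
      + (6 * (X - X ^ 2) * derivative f + 2 * (1 - 2 * X) * f) * ef - (1 - 2 * X) * eg

/-- Clausen's identity for terminating hypergeometric series. -/
theorem clausen_of_ascPochhammer_mul_eq_zero {K : Type*} [Field K] [CharZero K] (n : ℕ) (a z : K)
    (ha : (ascPochhammer K n).eval a * (ascPochhammer K n).eval (1 - a) = 0) :
    (∑ k ∈ Finset.range n,
        (ascPochhammer K k).eval a * (ascPochhammer K k).eval (1 - a) / (k.factorial : K) ^ 2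
          * z ^ k) ^ 2
      = ∑ k ∈ Finset.range n, (k.centralBinom : K)
          * ((ascPochhammer K k).eval a * (ascPochhammer K k).eval (1 - a)
            / (k.factorial : K) ^ 2) * (z * (1 - z)) ^ k := by
  set c : ℕ → K := fun k =>
    (ascPochhammer K k).eval a * (ascPochhammer K k).eval (1 - a) / (k.factorial : K) ^ 2 with hc
  have hrec : ∀ k : ℕ, ((k : K) + 1) ^ 2 * c (k + 1)
      = ((k : K) ^ 2 + k - (-(a * (1 - a)))) * c k := by
    intro k
    have h1 : (k.factorial : K) ≠ 0 := by exact_mod_cast k.factorial_ne_zero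
    have h2 : (k : K) + 1 ≠ 0 := by exact_mod_cast k.succ_ne_zero
    simp only [hc, ascPochhammer_succ_eval, Nat.factorial_succ]
    push_cast
    field_simp
    ring
  have hcn : ∀ k, n ≤ k → c k = 0 := by
    intro k hk
    induction k, hk using Nat.le_induction with
    | base => simp [hc, ha]
    | succ k _ ih =>
      have h2 : (k : K) + 1 ≠ 0 := by exact_mod_cast k.succ_ne_zero
      simpa [ih, h2] using hrec k
  have hcoeff : ∀ d : ℕ → K, (∀ k, n ≤ k → d k = 0) → ∀ m,
      (∑ k ∈ Finset.range n, C (d k) * X ^ k).coeff m = d m := by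
    intro d hd m
    simp only [finsetSum_coeff, coeff_C_mul, coeff_X_pow, mul_ite, mul_one, mul_zero,
      Finset.sum_ite_eq, Finset.mem_range]
    split_ifs with h
    · rfl
    · exact (hd m (not_lt.mp h)).symm
  have hf := hcoeff c hcn
  have hg := hcoeff (fun k => (k.centralBinom : K) * c k) (fun k hk => by simp [hcn k hk])
  have key := congrArg (eval z) (sq_eq_comp_of_coeff (-(a * (1 - a))) _ _
    (fun k => by rw [hf, hf]; exact hrec k)
    (fun k => by
      rw [hg, hg]
      have hb : ((k : K) + 1) * ((k + 1).centralBinom : K) = 2 * (2 * k + 1) * k.centralBinom := by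
        exact_mod_cast Nat.succ_mul_centralBinom_succ k
      linear_combination ((k : K) + 1) ^ 2 * c (k + 1) * hb
        + 2 * (2 * (k : K) + 1) * k.centralBinom * hrec k)
    (by rw [hf]; simp [hc]) (by rw [hg]; simp [hc]))
  simp only [eval_pow, eval_comp, eval_finsetSum, eval_mul, eval_C, eval_X, eval_sub] at key
  rw [key]
  simp only [show z - z ^ 2 = z * (1 - z) by ring, hc]

theorem ascPochhammer_eval_half {K : Type*} [Field K] [CharZero K] (k : ℕ) :
    (ascPochhammer K k).eval (1 / 2) * 4 ^ k = k.centralBinom * k.factorial := by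
  induction k with
  | zero => simp
  | succ k ih =>
    have hb : ((k : K) + 1) * ((k + 1).centralBinom : K) = 2 * (2 * k + 1) * k.centralBinom := by
      exact_mod_cast Nat.succ_mul_centralBinom_succ k
    rw [ascPochhammer_succ_eval, Nat.factorial_succ]
    push_cast
    linear_combination (4 * (1 / 2 + (k : K))) * ih - k.factorial * hb

theorem PadicInt.coe_ascPochhammer_eval (p : ℕ) [Fact p.Prime] (k : ℕ) (x : ℤ_[p]) :
    (((ascPochhammer ℤ_[p] k).eval x : ℤ_[p]) : ℚ_[p])
      = (ascPochhammer ℚ_[p] k).eval (x : ℚ_[p]) := by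
  induction k with
  | zero => simp
  | succ k ih => simp [ascPochhammer_succ_eval, ih]

theorem PadicInt.exists_mul_factorial_eq_one (p : ℕ) [Fact p.Prime] (k : ℕ) (hk : k < p) :
    ∃ u : ℤ_[p], u * (k.factorial : ℤ_[p]) = 1 := by
  have h : IsUnit (k.factorial : ℤ_[p]) := by
    rw [PadicInt.isUnit_iff, PadicInt.norm_natCast_eq_one_iff]
    exact (Fact.out : p.Prime).coprime_factorial_of_lt hk
  exact h.exists_left_inv

/-- A polynomial over `ℤ_[p]` vanishing at `0, -1, …, -(p-1)` and at `1, 2, …, p` has all its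
values divisible by `p ^ 2`. -/
theorem PadicInt.sq_dvd_eval_of_roots (p : ℕ) [Fact p.Prime] (D : ℤ_[p][X])
    (h1 : ∀ j < p, D.eval (-(j : ℤ_[p])) = 0) (h2 : ∀ j < p, D.eval (1 + (j : ℤ_[p])) = 0)
    (α : ℤ_[p]) : (p : ℤ_[p]) ^ 2 ∣ D.eval α := by
  have hres : ∀ x : ℤ_[p], ∃ j < p, (p : ℤ_[p]) ∣ x - j := fun x =>
    ⟨x.zmodRepr, x.zmodRepr_lt_p, by
      rw [← Ideal.mem_span_singleton, ← PadicInt.maximalIdeal_eq_span_p]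
      exact x.sub_zmodRepr_mem⟩
  obtain ⟨i, hi, hi'⟩ := hres (-α)
  obtain ⟨j, hj, hj'⟩ := hres (α - 1)
  obtain ⟨Q, rfl⟩ := dvd_iff_isRoot.mpr (h1 i hi)
  have hQ : Q.eval (1 + (j : ℤ_[p])) = 0 := by
    have h := h2 j hj
    rw [eval_mul] at h
    refine (mul_eq_zero.mp h).resolve_left ?_
    have : ((1 + j + i : ℕ) : ℤ_[p]) ≠ 0 := by exact_mod_cast (by omega : 1 + j + i ≠ 0)
    simpa using this
  obtain ⟨R, rfl⟩ := dvd_iff_isRoot.mpr hQ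
  rw [eval_mul, eval_mul, ← mul_assoc, sq]
  refine Dvd.dvd.mul_right (mul_dvd_mul ?_ ?_) _
  · rw [← dvd_neg]
    convert hi' using 1
    simp
    ring
  · convert hj' using 1
    simp
    ring

end Clausen

/-- p-adic analogue of Clausen's identity for truncated hypergeometric series mod `p²`. -/
theorem padic_clausen
    (p : ℕ) [Fact p.Prime] (hp : Odd p) (α z : ℤ_[p]) :
    ‖(∑ k ∈ Finset.range p,
        poch p (α : ℚ_[p]) k * poch p (1 - (α : ℚ_[p])) k / (Nat.factorial k : ℚ_[p]) ^ 2
          * (z : ℚ_[p]) ^ k) ^ 2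
      - ∑ k ∈ Finset.range p,
          poch p (α : ℚ_[p]) k * poch p (1 - (α : ℚ_[p])) k * poch p ((1 : ℚ_[p]) / 2) k
            / (Nat.factorial k : ℚ_[p]) ^ 3 * (4 * (z : ℚ_[p]) * (1 - (z : ℚ_[p]))) ^ k‖
      ≤ (p : ℝ) ^ (-2 : ℤ) := by
  choose! u hu using PadicInt.exists_mul_factorial_eq_one p
  have hu' : ∀ k < p, ((u k : ℤ_[p]) : ℚ_[p]) = 1 / (k.factorial : ℚ_[p]) := by
    intro k hk
    have h := congrArg (fun x : ℤ_[p] => (x : ℚ_[p])) (hu k hk)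
    push_cast at h
    exact eq_one_div_of_mul_eq_one_left h
  let A : ℕ → Polynomial ℤ_[p] := fun k =>
    ascPochhammer ℤ_[p] k * (ascPochhammer ℤ_[p] k).comp (1 - Polynomial.X)
  let D : Polynomial ℤ_[p] :=
    (∑ k ∈ Finset.range p, A k * Polynomial.C (u k ^ 2 * z ^ k)) ^ 2
      - ∑ k ∈ Finset.range p,
          A k * Polynomial.C ((k.centralBinom : ℤ_[p]) * u k ^ 2 * (z * (1 - z)) ^ k)
  have hD : ∀ a : ℤ_[p], ((D.eval a : ℤ_[p]) : ℚ_[p])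
      = (∑ k ∈ Finset.range p,
          (ascPochhammer ℚ_[p] k).eval (a : ℚ_[p]) * (ascPochhammer ℚ_[p] k).eval (1 - (a : ℚ_[p]))
            / (k.factorial : ℚ_[p]) ^ 2 * (z : ℚ_[p]) ^ k) ^ 2
        - ∑ k ∈ Finset.range p, (k.centralBinom : ℚ_[p])
          * ((ascPochhammer ℚ_[p] k).eval (a : ℚ_[p])
            * (ascPochhammer ℚ_[p] k).eval (1 - (a : ℚ_[p])) / (k.factorial : ℚ_[p]) ^ 2)
          * ((z : ℚ_[p]) * (1 - (z : ℚ_[p]))) ^ k := by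
    intro a
    simp only [D, A, Polynomial.eval_sub, Polynomial.eval_pow, Polynomial.eval_finsetSum,
      Polynomial.eval_mul, Polynomial.eval_C, Polynomial.eval_comp, Polynomial.eval_one,
      Polynomial.eval_X, PadicInt.coe_sub, PadicInt.coe_pow, PadicInt.coe_sum, PadicInt.coe_mul,
      PadicInt.coe_one, PadicInt.coe_natCast, PadicInt.coe_ascPochhammer_eval]
    refine congrArg₂ (· - ·) (congrArg (· ^ 2) ?_) ?_
    · refine Finset.sum_congr rfl fun k hk => ?_
      rw [hu' k (Finset.mem_range.mp hk)]
      ring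
    · refine Finset.sum_congr rfl fun k hk => ?_
      rw [hu' k (Finset.mem_range.mp hk)]
      ring
  have hroot : ∀ a : ℤ_[p], (ascPochhammer ℚ_[p] p).eval (a : ℚ_[p])
      * (ascPochhammer ℚ_[p] p).eval (1 - (a : ℚ_[p])) = 0 → D.eval a = 0 := by
    intro a ha
    rw [← PadicInt.coe_eq_zero, hD, sub_eq_zero]
    exact clausen_of_ascPochhammer_mul_eq_zero p _ _ ha
  have hneg : ∀ j < p, (ascPochhammer ℚ_[p] p).eval (-(j : ℚ_[p])) = 0 :=
    fun j hj => ascPochhammer_eval_neg_coe_nat_of_lt hj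
  have hdvd := PadicInt.sq_dvd_eval_of_roots p D
    (fun j hj => hroot _ (by push_cast; rw [hneg j hj, zero_mul]))
    (fun j hj => hroot _ (by push_cast; rw [sub_add_cancel_left, hneg j hj, mul_zero])) α
  have hnorm := (PadicInt.norm_le_pow_iff_mem_span_pow (D.eval α) 2).mpr
    (Ideal.mem_span_singleton.mpr hdvd)
  rw [PadicInt.norm_def, hD] at hnorm
  refine le_of_eq_of_le (congrArg norm (congrArg₂ (· - ·) rfl ?_)) hnorm
  refine Finset.sum_congr rfl fun k _ => ?_
  have hk : (k.factorial : ℚ_[p]) ≠ 0 := by exact_mod_cast k.factorial_ne_zero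
  have half := ascPochhammer_eval_half (K := ℚ_[p]) k
  simp only [poch]
  rw [mul_assoc 4, mul_pow 4]
  field_simp
  linear_combination (ascPochhammer ℚ_[p] k).eval (α : ℚ_[p])
    * (ascPochhammer ℚ_[p] k).eval (1 - (α : ℚ_[p]))
    * (((z : ℚ_[p]) * (1 - (z : ℚ_[p]))) ^ k) * half
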